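/- Let u : Ω → ℝ be a C² solution of div(∇u/√(1+|∇u|²)) = λ on an open set Ω ⊂ ℝ², with λ a constant. Then for every bounded open Lipschitz set E with closure compactly contained in Ω and |E| > 0, one has the strict inequality λ < P(E)/|E|. -/

import Mathlib

open MeasureTheory

local notation "E2" => EuclideanSpace ℝ (Fin 2)

noncomputable def perim (E : Set E2) : ℝ := (μH[1] (frontier E)).toReal

def HasLipschitzBoundary (E : Set E2) : Prop :=
  ∀ x ∈ frontier E, ∃ (K : NNReal) (e : E2 ≃ₗᵢ[ℝ] E2) (f : ℝ → ℝ) (U : Set E2),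
    IsOpen U ∧ x ∈ U ∧ LipschitzWith K f ∧
    E ∩ U = {y ∈ U | e y 1 < f (e y 0)}

noncomputable def Tvf (u : E2 → ℝ) (x : E2) : E2 :=
  (Real.sqrt (1 + ‖gradient u x‖ ^ 2))⁻¹ • gradient u x

noncomputable def div2 (T : E2 → E2) (x : E2) : ℝ :=
  ∑ i : Fin 2, fderiv ℝ T x (EuclideanSpace.single i 1) i


def tubeSet (S : Set E2) (v : E2) (h : ℝ) : Set E2 :=
  (fun p : E2 × ℝ => p.1 + p.2 • v) '' (S ×ˢ Set.Icc 0 h)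

lemma volume_tubeSet_piece (S : Set E2) (v : E2) (hv : ‖v‖ = 1) (h : ℝ) :
    volume (tubeSet S v h) ≤ (Metric.ediam S + ENNReal.ofReal h) * Metric.ediam S := by
  have hon : Orthonormal ℝ (({0} : Set (Fin 2)).domRestrict (fun _ => v)) := by
    constructor
    · intro i; simpa using hv
    · intro i j hij
      exact absurd (Subsingleton.elim i j) hij
  obtain ⟨b, hb⟩ := hon.exists_orthonormalBasis_extension_of_card_eq (by simp)
  have hb0 : b 0 = v := hb 0 rfl
  set g : E2 ≃ᵐ (Fin 2 → ℝ) := b.measurableEquiv.trans (MeasurableEquiv.toLp 2 (Fin 2 → ℝ)).symm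
  have hg : MeasurePreserving g volume volume :=
    (EuclideanSpace.volume_preserving_symm_measurableEquiv_toLp (Fin 2)).comp
      b.measurePreserving_measurableEquiv
  have hgi : ∀ x i, g x i = inner ℝ (b i) x := by
    intro x i
    exact b.repr_apply_apply x i
  have h1 : volume (tubeSet S v h) ≤ volume (g '' tubeSet S v h) := by
    rw [← hg.measure_preimage_equiv]
    exact measure_mono (Set.subset_preimage_image _ _)
  refine h1.trans ((Real.volume_pi_le_prod_diam _).trans ?_)
  rw [Fin.prod_univ_two]
  have key : ∀ (i : Fin 2) (z z' : E2), z ∈ S → z' ∈ S → edist (inner ℝ (b i) z) (inner ℝ (b i) z') ≤ Metric.ediam S := by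
    intro i z z' hz hz'
    refine le_trans ?_ (Metric.edist_le_ediam_of_mem hz hz')
    rw [edist_dist, edist_dist]
    apply ENNReal.ofReal_le_ofReal
    rw [Real.dist_eq, ← inner_sub_right, dist_eq_norm]
    refine (abs_real_inner_le_norm _ _).trans ?_
    simp
  gcongr
  · apply Metric.ediam_le
    rintro _ ⟨_, ⟨_, ⟨⟨z, s⟩, ⟨hz, hs⟩, rfl⟩, rfl⟩, rfl⟩ _ ⟨_, ⟨_, ⟨⟨z', s'⟩, ⟨hz', hs'⟩, rfl⟩, rfl⟩, rfl⟩
    simp only [Function.eval, hgi, inner_add_right, inner_smul_right, hb0, real_inner_self_eq_norm_sq, hv]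
    refine (edist_add_add_le _ _ _ _).trans ?_
    gcongr
    · rw [← hb0]; exact key 0 z z' hz hz'
    · rw [edist_dist, Real.dist_eq]
      apply ENNReal.ofReal_le_ofReal
      simp only [Set.mem_Icc] at hs hs'
      rw [abs_le]; constructor <;> linarith
  · apply Metric.ediam_le
    rintro _ ⟨_, ⟨_, ⟨⟨z, s⟩, ⟨hz, hs⟩, rfl⟩, rfl⟩, rfl⟩ _ ⟨_, ⟨_, ⟨⟨z', s'⟩, ⟨hz', hs'⟩, rfl⟩, rfl⟩, rfl⟩
    have h10 : inner ℝ (b 1) v = 0 := by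
      rw [← hb0]; exact b.orthonormal.2 (by simp)
    simp only [Function.eval, hgi, inner_add_right, inner_smul_right, h10, mul_zero, add_zero]
    exact key 1 z z' hz hz'

lemma volume_tubeSet (S : Set E2) (v : E2) (hv : ‖v‖ = 1) (h : ℝ) (hh : 0 < h) :
    volume (tubeSet S v h) ≤ ENNReal.ofReal h * μH[1] S := by
  have main : ∀ r : ℝ, 0 < r → volume (tubeSet S v h) ≤ ENNReal.ofReal (r + h) * μH[1] S := by
    intro r hr
    have hne : ENNReal.ofReal (r + h) ≠ 0 := by
      simp only [ne_eq, ENNReal.ofReal_eq_zero, not_le]; linarith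
    rw [mul_comm]
    apply (ENNReal.div_le_iff hne ENNReal.ofReal_ne_top).1
    rw [Measure.hausdorffMeasure_apply]
    refine le_trans ?_ (le_iSup₂ (ENNReal.ofReal r) (by simpa using hr))
    refine le_iInf fun t => le_iInf fun ht => le_iInf fun hd => ?_
    apply (ENNReal.div_le_iff hne ENNReal.ofReal_ne_top).2
    have hsub : tubeSet S v h ⊆ ⋃ n, tubeSet (t n) v h := by
      rintro _ ⟨⟨z, s⟩, ⟨hz, hs⟩, rfl⟩
      obtain ⟨n, hn⟩ := Set.mem_iUnion.1 (ht hz)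
      exact Set.mem_iUnion.2 ⟨n, ⟨⟨z, s⟩, ⟨hn, hs⟩, rfl⟩⟩
    refine (measure_mono hsub).trans ((measure_iUnion_le _).trans ?_)
    rw [← ENNReal.tsum_mul_right]
    refine ENNReal.tsum_le_tsum fun n => ?_
    refine (volume_tubeSet_piece (t n) v hv h).trans ?_
    rw [mul_comm]
    rcases (t n).eq_empty_or_nonempty with he | hne'
    · simp [he]
    · gcongr
      · simp [hne']
      · rw [ENNReal.ofReal_add hr.le hh.le]
        gcongr
        exact hd n
  by_cases hS : μH[1] S = ⊤
  · rw [hS, ENNReal.mul_top (by simpa using hh)]; exact le_top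
  have htend : Filter.Tendsto (fun r : ℝ => ENNReal.ofReal (r + h) * μH[1] S) (nhdsWithin 0 (Set.Ioi 0))
      (nhds (ENNReal.ofReal (0 + h) * μH[1] S)) := by
    apply ENNReal.Tendsto.mul_const _ (Or.inr hS)
    apply ENNReal.tendsto_ofReal
    exact ((continuous_id.add continuous_const).tendsto 0).mono_left nhdsWithin_le_nhds
  rw [zero_add] at htend
  refine ge_of_tendsto htend ?_
  filter_upwards [self_mem_nhdsWithin] with r hr using main r hr

lemma tubeSet_isCompact {S : Set E2} (hS : IsCompact S) (v : E2) (h : ℝ) :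
    IsCompact (tubeSet S v h) :=
  (hS.prod isCompact_Icc).image (by fun_prop)

lemma hausdorff_frontier_lt_top (E : Set E2) (hE : IsOpen E) (hb : Bornology.IsBounded E)
    (hL : HasLipschitzBoundary E) : μH[1] (frontier E) < ⊤ := by
  have hc : IsCompact (frontier E) :=
    (hb.isCompact_closure).of_isClosed_subset isClosed_frontier frontier_subset_closure
  apply hc.measure_lt_top_of_nhdsWithin
  intro x hx
  obtain ⟨K, e, f, U, hU, hxU, hf, hEU⟩ := hL x hx
  refine ⟨U ∩ frontier E ∩ Metric.ball x 1, ?_, ?_⟩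
  · exact Filter.inter_mem (Filter.inter_mem (mem_nhdsWithin_of_mem_nhds (hU.mem_nhds hxU)) self_mem_nhdsWithin)
      (mem_nhdsWithin_of_mem_nhds (Metric.ball_mem_nhds x one_pos))
  set γ : ℝ → E2 := fun t => e.symm (WithLp.toLp 2 ![t, f t])
  have hγ : LipschitzWith (1 + K) γ := by
    apply LipschitzWith.of_dist_le_mul
    intro s t
    simp only [γ, LinearIsometryEquiv.dist_map]
    rw [EuclideanSpace.dist_eq]
    simp only [Fin.sum_univ_two]
    have h1 := hf.dist_le_mul s t
    apply Real.sqrt_le_iff.2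
    refine ⟨by positivity, ?_⟩
    simp only [Matrix.cons_val_zero, Matrix.cons_val_one]
    push_cast
    have h2 : 0 ≤ dist s t := dist_nonneg
    have h3 : 0 ≤ dist (f s) (f t) := dist_nonneg
    have h4 : (0:ℝ) ≤ K := K.2
    nlinarith [mul_nonneg h4 h2, mul_nonneg (mul_nonneg h4 h2) h2]
  have hsub : U ∩ frontier E ∩ Metric.ball x 1 ⊆ γ '' (Set.Icc (e x 0 - 1) (e x 0 + 1)) := by
    rintro y ⟨⟨hyU, hyE⟩, hyb⟩
    have hyn : y ∉ E := by
      rw [hE.frontier_eq] at hyE; exact hyE.2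
    have hcont0 : ∀ i, Continuous fun z : E2 => e z i := fun i => by fun_prop
    have hfc := hf.continuous
    have heq : e y 1 = f (e y 0) := by
      apply le_antisymm
      · by_contra! hlt
        have hopen : IsOpen (U ∩ {z : E2 | f (e z 0) < e z 1}) :=
          hU.inter (isOpen_lt (hfc.comp (hcont0 0)) (hcont0 1))
        obtain ⟨z, ⟨hzU, hz⟩, hzE⟩ := mem_closure_iff.1 (frontier_subset_closure hyE) _ hopen ⟨hyU, hlt⟩
        have : z ∈ E ∩ U := ⟨hzE, hzU⟩
        rw [hEU] at this
        exact absurd this.2 (not_lt.2 (le_of_lt hz))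
      · by_contra! hlt
        have : y ∈ E ∩ U := by rw [hEU]; exact ⟨hyU, hlt⟩
        exact hyn this.1
    refine ⟨e y 0, ?_, ?_⟩
    · have h1 : |e y 0 - e x 0| ≤ ‖e y - e x‖ := by
        have := PiLp.norm_apply_le (e y - e x) 0
        simpa using this
      rw [← map_sub, e.norm_map, ← dist_eq_norm] at h1
      have h2 : dist y x < 1 := hyb
      have := abs_le.1 (h1.trans h2.le)
      constructor <;> linarith [this.1, this.2]
    · simp only [γ]
      rw [← heq]
      apply e.injective
      rw [e.apply_symm_apply]
      ext i; fin_cases i <;> rfl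
  refine (measure_mono hsub).trans_lt ((hγ.hausdorffMeasure_image_le zero_le_one _).trans_lt ?_)
  rw [hausdorffMeasure_real]
  exact ENNReal.mul_lt_top (by simp) (by simp [Real.volume_Icc])

lemma mem_tube_of_cross (E : Set E2) (v x : E2) (h : ℝ) (hh : 0 ≤ h) (h1 : x - h • v ∈ E) (h2 : x ∉ E) :
    x ∈ tubeSet (frontier E) v h := by
  have hc : IsPreconnected ((fun s : ℝ => x - s • v) '' Set.Icc 0 h) :=
    isPreconnected_Icc.image _ (by fun_prop)
  by_contra hcon
  have hno : ∀ y ∈ (fun s : ℝ => x - s • v) '' Set.Icc 0 h, y ∉ frontier E := by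
    rintro _ ⟨s, hs, rfl⟩ hz
    exact hcon ⟨⟨x - s • v, s⟩, ⟨hz, hs⟩, by simp⟩
  have hx : x ∈ (fun s : ℝ => x - s • v) '' Set.Icc 0 h := ⟨0, ⟨le_rfl, hh⟩, by simp⟩
  have hdich : ∀ y ∈ (fun s : ℝ => x - s • v) '' Set.Icc 0 h, y ∈ interior E ∨ y ∈ (closure E)ᶜ := by
    intro y hy
    by_contra! hc2
    exact hno y hy ⟨not_not.1 hc2.2, hc2.1⟩
  have hxm : x - h • v ∈ (fun s : ℝ => x - s • v) '' Set.Icc 0 h := ⟨h, ⟨hh, le_rfl⟩, rfl⟩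
  obtain ⟨z, -, hz1, hz2⟩ := hc (interior E) (closure E)ᶜ isOpen_interior isClosed_closure.isOpen_compl
    hdich ⟨_, hxm, (hdich _ hxm).resolve_right (fun hn => hn (subset_closure h1))⟩
    ⟨x, hx, (hdich _ hx).resolve_left (fun hn => h2 (interior_subset hn))⟩
  exact hz2 (subset_closure (interior_subset hz1))

lemma lintegral_tubeSet (A : Set E2) (φ : E2 → ℝ) (K : NNReal) (hK : LipschitzWith K φ)
    (h0 : ∀ x, 0 ≤ φ x) (v : E2) (hv : ‖v‖ = 1) (h : ℝ) (hh : 0 < h) :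
    ∫⁻ x in tubeSet A v h, ENNReal.ofReal (φ x) ≤
      ENNReal.ofReal h * ∫⁻ x in A, ENNReal.ofReal (φ x + K * h) ∂μH[1] := by
  have hm : Measurable φ := hK.continuous.measurable
  have hm2 : Measurable fun x => φ x + K * h := hm.add_const _
  rw [lintegral_eq_lintegral_meas_lt _ (Filter.Eventually.of_forall h0) hm.aemeasurable,
    lintegral_eq_lintegral_meas_lt (f := fun x => φ x + K * h) _
      (Filter.Eventually.of_forall fun x => add_nonneg (h0 x) (by positivity)) hm2.aemeasurable,
    ← lintegral_const_mul' _ _ ENNReal.ofReal_ne_top]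
  refine lintegral_mono fun t => ?_
  rw [Measure.restrict_apply (measurableSet_lt measurable_const hm),
    Measure.restrict_apply (measurableSet_lt measurable_const hm2)]
  refine le_trans (measure_mono ?_) (volume_tubeSet _ v hv h hh)
  rintro _ ⟨ht, ⟨⟨z, s⟩, ⟨hz, hs⟩, rfl⟩⟩
  refine ⟨⟨z, s⟩, ⟨⟨?_, hz⟩, hs⟩, rfl⟩
  simp only [Set.mem_ofPred_eq] at ht ⊢
  have h1 := hK.dist_le_mul (z + s • v) z
  rw [Real.dist_eq, dist_eq_norm, add_sub_cancel_left, norm_smul, hv, mul_one, Real.norm_eq_abs,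
    abs_of_nonneg hs.1] at h1
  have h2 := le_abs_self (φ (z + s • v) - φ z)
  have h3 : (K:ℝ) * s ≤ K * h := mul_le_mul_of_nonneg_left hs.2 K.2
  linarith

lemma key_diff (E : Set E2) (hE : IsOpen E) (hb : Bornology.IsBounded E)
    (hfin : μH[1] (frontier E) < ⊤)
    (φ : E2 → ℝ) (K : NNReal) (hK : LipschitzWith K φ) (hc : HasCompactSupport φ)
    (h0 : ∀ x, 0 ≤ φ x) (v : E2) (hv : ‖v‖ = 1) (h : ℝ) (hh : 0 < h) :
    (∫ x in E, φ (x + h • v)) - ∫ x in E, φ x ≤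
      h * ((∫ x in frontier E, φ x ∂μH[1]) + K * h * perim E) := by
  have hA : IsCompact (frontier E) :=
    (hb.isCompact_closure).of_isClosed_subset isClosed_frontier frontier_subset_closure
  have : IsFiniteMeasure ((μH[1] : Measure E2).restrict (frontier E)) :=
    ⟨by rw [Measure.restrict_apply_univ]; exact hfin⟩
  have hcont := hK.continuous
  have hint : Integrable φ volume := hcont.integrable_of_hasCompactSupport hc
  have hintA : Integrable φ ((μH[1] : Measure E2).restrict (frontier E)) :=
    hcont.integrable_of_hasCompactSupport hc
  have hT : MeasurableSet (tubeSet (frontier E) v h) := (tubeSet_isCompact hA v h).isClosed.measurableSet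
  have hE' : MeasurableSet {x : E2 | x - h • v ∈ E} :=
    (hE.preimage (continuous_id.sub continuous_const)).measurableSet
  have e1 : ∫ x in E, φ (x + h • v) = ∫ x, {x : E2 | x - h • v ∈ E}.indicator φ x := by
    rw [← integral_indicator hE.measurableSet,
      ← integral_add_right_eq_self (fun x => {x : E2 | x - h • v ∈ E}.indicator φ x) (h • v)]
    congr 1
    ext x
    have hiff : x + h • v - h • v = x := add_sub_cancel_right _ _
    simp only [Set.indicator, Set.mem_ofPred_eq]
    by_cases hx : x ∈ E
    · rw [if_pos hx, if_pos (by rw [hiff]; exact hx)]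
    · rw [if_neg hx, if_neg (by rw [hiff]; exact hx)]
  have step1 : (∫ x in E, φ (x + h • v)) - ∫ x in E, φ x ≤ ∫ x in tubeSet (frontier E) v h, φ x := by
    rw [e1, ← integral_indicator hE.measurableSet, ← integral_indicator hT,
      ← integral_sub (hint.indicator hE') (hint.indicator hE.measurableSet)]
    refine integral_mono ((hint.indicator hE').sub (hint.indicator hE.measurableSet))
      (hint.indicator hT) fun x => ?_
    have hn : 0 ≤ (tubeSet (frontier E) v h).indicator φ x := Set.indicator_nonneg (fun x _ => h0 x) x
    have h0x := h0 x
    by_cases h1 : x - h • v ∈ E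
    · by_cases h2 : x ∈ E
      · simpa [Set.indicator, h1, h2] using hn
      · have := mem_tube_of_cross E v x h hh.le h1 h2
        simp [Set.indicator, h1, h2, this]
    · by_cases h2 : x ∈ E
      · simp only [Set.indicator, Set.mem_ofPred_eq, h1, h2, if_true, if_false] at hn ⊢
        linarith
      · simpa [Set.indicator, h1, h2] using hn
  refine step1.trans ?_
  have e2 : (∫ x in frontier E, φ x ∂μH[1]) + K * h * perim E
      = ∫ x in frontier E, (φ x + K * h) ∂μH[1] := by
    rw [integral_add hintA (integrable_const _)]
    simp [perim, Measure.real, mul_comm]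
  rw [e2, integral_eq_lintegral_of_nonneg_ae (Filter.Eventually.of_forall h0) hcont.aestronglyMeasurable,
    integral_eq_lintegral_of_nonneg_ae
      (Filter.Eventually.of_forall fun x => add_nonneg (h0 x) (by positivity))
      (hcont.add continuous_const).aestronglyMeasurable]
  have := lintegral_tubeSet (frontier E) φ K hK h0 v hv h hh
  have hne : ∫⁻ x in frontier E, ENNReal.ofReal (φ x + K * h) ∂μH[1] ≠ ⊤ :=
    ((hintA.add (integrable_const (K * h : ℝ))).lintegral_lt_top).ne
  have h2 := ENNReal.toReal_mono (ENNReal.mul_ne_top ENNReal.ofReal_ne_top hne) this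
  rwa [ENNReal.toReal_mul, ENNReal.toReal_ofReal hh.le] at h2

lemma key_unit (E : Set E2) (hE : IsOpen E) (hb : Bornology.IsBounded E)
    (hfin : μH[1] (frontier E) < ⊤)
    (φ : E2 → ℝ) (hφ : ContDiff ℝ 1 φ) (hc : HasCompactSupport φ)
    (h0 : ∀ x, 0 ≤ φ x) (v : E2) (hv : ‖v‖ = 1) :
    ∫ x in E, fderiv ℝ φ x v ≤ ∫ x in frontier E, φ x ∂μH[1] := by
  obtain ⟨K, hK⟩ := hφ.lipschitzWith_of_hasCompactSupport hc one_ne_zero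
  have : IsFiniteMeasure ((volume : Measure E2).restrict E) :=
    ⟨by rw [Measure.restrict_apply_univ]; exact hb.measure_lt_top⟩
  have hcont := hφ.continuous
  have hfd : Continuous fun x => fderiv ℝ φ x := hφ.continuous_fderiv one_ne_zero
  have hder : HasDerivAt (fun h : ℝ => ∫ x in E, φ (x + h • v)) (∫ x in E, fderiv ℝ φ (x + (0:ℝ) • v) v) 0 := by
    refine (hasDerivAt_integral_of_dominated_loc_of_deriv_le (F := fun (h : ℝ) x => φ (x + h • v))
      (F' := fun (h : ℝ) x => fderiv ℝ φ (x + h • v) v) (s := Set.univ) (bound := fun _ => (K : ℝ))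
      Filter.univ_mem ?_ ?_ ?_ ?_ (integrable_const _) ?_).2
    · exact Filter.Eventually.of_forall fun h => (by fun_prop : Continuous fun x => φ (x + h • v)).aestronglyMeasurable
    · simp only [zero_smul, add_zero]
      exact (hcont.integrable_of_hasCompactSupport hc).integrableOn
    · exact (by fun_prop : Continuous fun x => fderiv ℝ φ (x + (0:ℝ) • v) v).aestronglyMeasurable
    · refine Filter.Eventually.of_forall fun x h _ => ?_
      refine ((fderiv ℝ φ (x + h • v)).le_opNorm v).trans ?_
      rw [hv, mul_one]
      exact norm_fderiv_le_of_lipschitz ℝ hK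
    · refine Filter.Eventually.of_forall fun x h _ => ?_
      have h1 : HasDerivAt (fun h : ℝ => x + h • v) v h := by
        simpa using ((hasDerivAt_id h).smul_const v).const_add x
      have h2 := (hφ.differentiable one_ne_zero (x + h • v)).hasFDerivAt
      exact h2.comp_hasDerivAt h h1
  simp only [zero_smul, add_zero] at hder
  have ht := hder.tendsto_slope_zero_right
  have hr : Filter.Tendsto (fun h : ℝ => (∫ x in frontier E, φ x ∂μH[1]) + K * h * perim E)
      (nhdsWithin 0 (Set.Ioi 0)) (nhds ((∫ x in frontier E, φ x ∂μH[1]) + K * 0 * perim E)) :=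
    ((by fun_prop : Continuous fun h : ℝ => (∫ x in frontier E, φ x ∂μH[1]) + K * h * perim E).tendsto 0).mono_left
      nhdsWithin_le_nhds
  simp only [mul_zero, zero_mul, add_zero] at hr
  refine le_of_tendsto_of_tendsto ht hr ?_
  filter_upwards [self_mem_nhdsWithin] with h hh
  have hh' : 0 < h := hh
  have := key_diff E hE hb hfin φ K hK hc h0 v hv h hh'
  simp only [zero_add, zero_smul, add_zero, smul_eq_mul]
  rw [inv_mul_le_iff₀ hh']
  exact this

lemma key_gen (E : Set E2) (hE : IsOpen E) (hb : Bornology.IsBounded E)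
    (hfin : μH[1] (frontier E) < ⊤)
    (φ : E2 → ℝ) (hφ : ContDiff ℝ 1 φ) (hc : HasCompactSupport φ)
    (h0 : ∀ x, 0 ≤ φ x) (v : E2) :
    ∫ x in E, fderiv ℝ φ x v ≤ ∫ x in frontier E, ‖v‖ * φ x ∂μH[1] := by
  by_cases hv : v = 0
  · simp [hv]
  have hn : 0 < ‖v‖ := norm_pos_iff.2 hv
  have h1 := key_unit E hE hb hfin φ hφ hc h0 (‖v‖⁻¹ • v) (by
    rw [norm_smul, norm_inv, norm_norm, inv_mul_cancel₀ hn.ne'])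
  simp only [map_smul, smul_eq_mul] at h1
  rw [integral_const_mul, inv_mul_le_iff₀ hn] at h1
  rwa [integral_const_mul]

lemma div2_contDiff {F : E2 → E2} (hF : ContDiff ℝ 1 F) : Continuous (div2 F) := by
  have hfd : Continuous fun x => fderiv ℝ F x := hF.continuous_fderiv one_ne_zero
  unfold div2
  refine continuous_finsetSum _ fun i _ => ?_
  have h1 : Continuous fun x => fderiv ℝ F x (EuclideanSpace.single i 1) := by fun_prop
  exact (PiLp.continuous_apply 2 _ i).comp h1

lemma div2_hasCompactSupport {F : E2 → E2} (hc : HasCompactSupport F) :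
    HasCompactSupport (div2 F) := by
  refine HasCompactSupport.intro (hc.fderiv ℝ) fun x hx => ?_
  have : fderiv ℝ F x = 0 := image_eq_zero_of_notMem_tsupport hx
  simp [div2, this]

lemma div2_ibp (F : E2 → E2) (hF : ContDiff ℝ 1 F) (hc : HasCompactSupport F)
    (ψ : E2 → ℝ) (hψ : ContDiff ℝ 1 ψ) (y : E2) :
    ∫ x, fderiv ℝ ψ (y - x) (F x) = ∫ x, ψ (y - x) * div2 F x := by
  have hψd : Continuous fun x => fderiv ℝ ψ x := hψ.continuous_fderiv one_ne_zero
  have hFd : Continuous fun x => fderiv ℝ F x := hF.continuous_fderiv one_ne_zero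
  have hψc := hψ.continuous
  have hFc := hF.continuous
  set e : Fin 2 → E2 := fun i => EuclideanSpace.single i 1 with he
  set g : E2 → ℝ := fun x => ψ (y - x) with hg
  have hgC : ContDiff ℝ 1 g := hψ.comp (contDiff_const.sub contDiff_id)
  have hgd : ∀ x w, fderiv ℝ g x w = - fderiv ℝ ψ (y - x) w := by
    intro x w
    have h1 : HasFDerivAt (fun x : E2 => y - x) (-ContinuousLinearMap.id ℝ E2) x :=
      (hasFDerivAt_id x).const_sub y
    have h2 := ((hψ.differentiable one_ne_zero (y - x)).hasFDerivAt).comp x h1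
    have h3 : fderiv ℝ g x = _ := h2.fderiv
    rw [h3]; simp
  have hFi : ∀ i : Fin 2, ContDiff ℝ 1 fun x => F x i := fun i => contDiff_euclidean.1 hF i
  have hFid : ∀ (i : Fin 2) x w, fderiv ℝ (fun x => F x i) x w = fderiv ℝ F x w i := by
    intro i x w
    have h1 := ((EuclideanSpace.proj i : E2 →L[ℝ] ℝ).hasFDerivAt (x := F x)).comp x
      (hF.differentiable one_ne_zero x).hasFDerivAt
    have h2 : fderiv ℝ (fun x => F x i) x = _ := h1.fderiv
    rw [h2]; rfl
  have hcs : ∀ {G : E2 → ℝ}, Continuous G → (∀ x, x ∉ tsupport F → G x = 0) → Integrable G volume :=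
    fun hG h => hG.integrable_of_hasCompactSupport (HasCompactSupport.intro hc h)
  have hF0 : ∀ x, x ∉ tsupport F → F x = 0 := fun x hx => image_eq_zero_of_notMem_tsupport hx
  have hFd0 : ∀ x, x ∉ tsupport F → fderiv ℝ F x = 0 := fun x hx =>
    image_eq_zero_of_notMem_tsupport (fun h => hx (tsupport_fderiv_subset ℝ h))
  have hic : ∀ i : Fin 2, Continuous fun x => F x i := fun i => (hFi i).continuous
  have hi1 : ∀ i : Fin 2, Integrable (fun x => fderiv ℝ ψ (y - x) (e i) * F x i) volume := by
    intro i
    refine hcs ?_ fun x hx => by simp [hF0 x hx]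
    exact (by fun_prop : Continuous fun x => fderiv ℝ ψ (y - x) (e i)).mul (hic i)
  have hi2 : ∀ i : Fin 2, Integrable (fun x => g x * fderiv ℝ (fun x => F x i) x (e i)) volume := by
    intro i
    refine hcs ?_ fun x hx => by simp [hFid, hFd0 x hx]
    have := (hFi i).continuous_fderiv one_ne_zero
    have := hgC.continuous
    fun_prop
  have hpart : ∀ i : Fin 2, ∫ x, g x * fderiv ℝ (fun x => F x i) x (e i)
      = ∫ x, fderiv ℝ ψ (y - x) (e i) * F x i := by
    intro i
    rw [integral_mul_fderiv_eq_neg_fderiv_mul_of_integrable, ← integral_neg]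
    · congr 1; ext x; rw [hgd]; ring
    · simp only [hgd, neg_mul]; exact (hi1 i).neg
    · exact hi2 i
    · exact hcs (hgC.continuous.mul (hic i)) fun x hx => by simp [hF0 x hx]
    · exact fun x _ => hgC.differentiable one_ne_zero x
    · exact fun x _ => (hFi i).differentiable one_ne_zero x
  calc ∫ x, fderiv ℝ ψ (y - x) (F x)
      = ∫ x, ∑ i : Fin 2, fderiv ℝ ψ (y - x) (e i) * F x i := by
        congr 1; ext x
        have : F x = ∑ i : Fin 2, F x i • e i := by
          ext j
          fin_cases j <;> simp [he, Fin.sum_univ_two]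
        conv_lhs => rw [this]
        rw [map_sum]
        exact Finset.sum_congr rfl fun i _ => by rw [map_smul, smul_eq_mul, mul_comm]
    _ = ∑ i : Fin 2, ∫ x, fderiv ℝ ψ (y - x) (e i) * F x i := integral_finsetSum _ fun i _ => hi1 i
    _ = ∑ i : Fin 2, ∫ x, g x * fderiv ℝ (fun x => F x i) x (e i) :=
        Finset.sum_congr rfl fun i _ => (hpart i).symm
    _ = ∫ x, ∑ i : Fin 2, g x * fderiv ℝ (fun x => F x i) x (e i) :=
        (integral_finsetSum _ fun i _ => hi2 i).symm
    _ = ∫ x, ψ (y - x) * div2 F x := by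
        congr 1; ext x
        simp only [div2, Finset.mul_sum, hFid]
        rfl

lemma main_mollified (E : Set E2) (hE : IsOpen E) (hb : Bornology.IsBounded E)
    (hfin : μH[1] (frontier E) < ⊤) (F : E2 → E2) (hF : ContDiff ℝ 1 F) (hc : HasCompactSupport F)
    (c : ℝ) (hFc : ∀ x, ‖F x‖ ≤ c) (ψ : E2 → ℝ) (hψ : ContDiff ℝ 1 ψ) (hψc : HasCompactSupport ψ)
    (h0 : ∀ x, 0 ≤ ψ x) (h1 : ∫ x, ψ x = 1) :
    IntegrableOn (fun y => ∫ x, ψ (y - x) * div2 F x) E ∧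
    ∫ y in E, ∫ x, ψ (y - x) * div2 F x ≤ c * perim E := by
  have hψd : Continuous fun x => fderiv ℝ ψ x := hψ.continuous_fderiv one_ne_zero
  have hψcont := hψ.continuous
  have hFcont := hF.continuous
  have : IsFiniteMeasure ((volume : Measure E2).restrict E) :=
    ⟨by rw [Measure.restrict_apply_univ]; exact hb.measure_lt_top⟩
  have : IsFiniteMeasure ((μH[1] : Measure E2).restrict (frontier E)) :=
    ⟨by rw [Measure.restrict_apply_univ]; exact hfin⟩
  have hcomp : IsCompact ((fun p : E2 × E2 => (p.1, p.1 + p.2)) '' (tsupport F ×ˢ tsupport ψ)) :=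
    (IsCompact.prod hc hψc).image (by fun_prop)
  have hout : ∀ p : E2 × E2, p ∉ (fun p : E2 × E2 => (p.1, p.1 + p.2)) '' (tsupport F ×ˢ tsupport ψ) →
      F p.1 = 0 ∨ (ψ (p.2 - p.1) = 0 ∧ fderiv ℝ ψ (p.2 - p.1) = 0) := by
    intro p hp
    by_cases h : p.1 ∈ tsupport F
    · right
      have h' : p.2 - p.1 ∉ tsupport ψ := fun h' => hp ⟨(p.1, p.2 - p.1), ⟨h, h'⟩, by simp⟩
      exact ⟨image_eq_zero_of_notMem_tsupport h',
        image_eq_zero_of_notMem_tsupport (fun h => h' (tsupport_fderiv_subset ℝ h))⟩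
    · exact Or.inl (image_eq_zero_of_notMem_tsupport h)
  have hint1 : Integrable (Function.uncurry fun x y : E2 => fderiv ℝ ψ (y - x) (F x))
      (volume.prod (volume.restrict E)) := by
    refine Continuous.integrable_of_hasCompactSupport ?_ (HasCompactSupport.intro hcomp fun p hp => ?_)
    · simp only [Function.uncurry_def]
      fun_prop
    · rcases hout p hp with h | h
      · simp [Function.uncurry_def, h]
      · simp [Function.uncurry_def, h.2]
  have hint2 : Integrable (Function.uncurry fun x y : E2 => ‖F x‖ * ψ (y - x))
      (volume.prod ((μH[1] : Measure E2).restrict (frontier E))) := by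
    refine Continuous.integrable_of_hasCompactSupport ?_ (HasCompactSupport.intro hcomp fun p hp => ?_)
    · simp only [Function.uncurry_def]
      fun_prop
    · rcases hout p hp with h | h
      · simp [Function.uncurry_def, h]
      · simp [Function.uncurry_def, h.1]
  have hibp := div2_ibp F hF hc ψ hψ
  simp only [← hibp]
  refine ⟨hint1.integral_prod_right, ?_⟩
  rw [← integral_integral_swap hint1]
  have hψi : Integrable ψ volume := hψcont.integrable_of_hasCompactSupport hψc
  calc ∫ x, ∫ y in E, fderiv ℝ ψ (y - x) (F x)
      ≤ ∫ x, ∫ y in frontier E, ‖F x‖ * ψ (y - x) ∂μH[1] := by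
        refine integral_mono hint1.integral_prod_left hint2.integral_prod_left fun x => ?_
        have hφ : ContDiff ℝ 1 fun y => ψ (y - x) := hψ.comp (contDiff_id.sub contDiff_const)
        have hφc : HasCompactSupport fun y => ψ (y - x) := by
          exact hψc.comp_homeomorph (Homeomorph.subRight x)
        have := key_gen E hE hb hfin (fun y => ψ (y - x)) hφ hφc (fun y => h0 _) (F x)
        have hd : ∀ y, fderiv ℝ (fun y => ψ (y - x)) y = fderiv ℝ ψ (y - x) := by
          intro y
          have h2 := ((hψ.differentiable one_ne_zero (y - x)).hasFDerivAt).comp y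
            ((hasFDerivAt_id y).sub_const x)
          exact h2.fderiv
        simpa only [hd] using this
    _ = ∫ y in frontier E, (∫ x, ‖F x‖ * ψ (y - x)) ∂μH[1] := integral_integral_swap hint2
    _ ≤ ∫ y in frontier E, c ∂μH[1] := by
        refine integral_mono hint2.integral_prod_right (integrable_const _) fun y => ?_
        have hi : Integrable (fun x => ψ (y - x)) volume := hψi.comp_sub_left y
        calc ∫ x, ‖F x‖ * ψ (y - x) ≤ ∫ x, c * ψ (y - x) := by
              refine integral_mono_of_nonneg (Filter.Eventually.of_forall fun x => mul_nonneg (norm_nonneg _) (h0 _))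
                (hi.const_mul c) (Filter.Eventually.of_forall fun x => mul_le_mul_of_nonneg_right (hFc x) (h0 _))
          _ = c := by
            rw [integral_const_mul, integral_sub_left_eq_self ψ volume y, h1, mul_one]
    _ = c * perim E := by
        simp [perim, Measure.real, mul_comm]

lemma main_ineq (E : Set E2) (hE : IsOpen E) (hb : Bornology.IsBounded E)
    (hfin : μH[1] (frontier E) < ⊤) (F : E2 → E2) (hF : ContDiff ℝ 1 F) (hc : HasCompactSupport F)
    (c : ℝ) (hFc : ∀ x, ‖F x‖ ≤ c) :
    ∫ y in E, div2 F y ≤ c * perim E := by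
  have : IsFiniteMeasure ((volume : Measure E2).restrict E) :=
    ⟨by rw [Measure.restrict_apply_univ]; exact hb.measure_lt_top⟩
  have hDc := div2_contDiff hF
  have hDs := div2_hasCompactSupport hc
  have hDi : Integrable (div2 F) volume := hDc.integrable_of_hasCompactSupport hDs
  have hmain : ∀ η : ℝ, 0 < η → ∫ y in E, div2 F y ≤ c * perim E + η * (volume E).toReal := by
    intro η hη
    obtain ⟨ε, hε, hεη⟩ := Metric.uniformContinuous_iff.1 (hDs.uniformContinuous_of_continuous hDc) η hη
    let f : ContDiffBump (0 : E2) := ⟨ε / 2, ε, by linarith, by linarith⟩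
    have h0 : ∀ x, 0 ≤ f.normed volume x := f.nonneg_normed
    have h1 : ∫ x, f.normed volume x = 1 := f.integral_normed
    have hC : ContDiff ℝ 1 (f.normed volume) := f.contDiff_normed (n := 1)
    have hCs : HasCompactSupport (f.normed volume) := f.hasCompactSupport_normed
    obtain ⟨hi, hle⟩ := main_mollified E hE hb hfin F hF hc c hFc _ hC hCs h0 h1
    have hi0 : Integrable (f.normed volume) volume := hC.continuous.integrable_of_hasCompactSupport hCs
    have hpt : ∀ y, div2 F y - η ≤ ∫ x, f.normed volume (y - x) * div2 F x := by
      intro y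
      have hiy : Integrable (fun x => f.normed volume (y - x)) volume := hi0.comp_sub_left y
      have : div2 F y - η = ∫ x, f.normed volume (y - x) * (div2 F y - η) := by
        rw [integral_mul_const, integral_sub_left_eq_self _ volume y, h1, one_mul]
      rw [this]
      have hcy : Continuous fun x => f.normed volume (y - x) * div2 F x :=
        (hC.continuous.comp (continuous_const.sub continuous_id)).mul hDc
      refine integral_mono (hiy.mul_const _) (hcy.integrable_of_hasCompactSupport hDs.mul_left) fun x => ?_
      by_cases hx : y - x ∈ Metric.ball (0 : E2) ε
      · apply mul_le_mul_of_nonneg_left _ (h0 _)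
        rw [mem_ball_zero_iff, ← dist_eq_norm, dist_comm] at hx
        have := hεη hx
        rw [Real.dist_eq] at this
        have := (abs_lt.1 this).1
        linarith
      · have : f.normed volume (y - x) = 0 := by
          by_contra hne
          have : y - x ∈ Function.support (f.normed volume) := hne
          rw [f.support_normed_eq] at this
          exact hx this
        simp [this]
    have hm : ∫ y in E, (div2 F y - η) ≤ ∫ y in E, ∫ x, f.normed volume (y - x) * div2 F x :=
      integral_mono (hDi.integrableOn.sub (integrable_const _)) hi hpt
    rw [integral_sub hDi.integrableOn (integrable_const _)] at hm
    simp only [integral_const, Measure.real, Measure.restrict_apply_univ, smul_eq_mul] at hm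
    linarith
  by_contra! hlt
  set d := ∫ y in E, div2 F y - c * perim E with hd
  have hV : 0 ≤ (volume E).toReal := ENNReal.toReal_nonneg
  have h2 := hmain (((∫ y in E, div2 F y) - c * perim E) / (2 * ((volume E).toReal + 1)))
    (div_pos (by linarith) (by linarith))
  have h3 : ((∫ y in E, div2 F y) - c * perim E) / (2 * ((volume E).toReal + 1)) * (volume E).toReal
      ≤ ((∫ y in E, div2 F y) - c * perim E) / 2 := by
    rw [div_mul_eq_mul_div, div_le_div_iff₀ (by linarith) (by norm_num)]
    nlinarith
  linarith

lemma exists_cutoff (Ω E : Set E2) (hΩ : IsOpen Ω) (hb : Bornology.IsBounded E) (hcl : closure E ⊆ Ω) :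
    ∃ (K : Set E2) (χ : E2 → ℝ), IsCompact K ∧ K ⊆ Ω ∧ ContDiff ℝ 1 χ ∧ tsupport χ ⊆ K ∧
      (∀ x ∈ E, χ x = 1) ∧ ∀ x, 0 ≤ χ x ∧ χ x ≤ 1 := by
  obtain ⟨K, hK, hEK, hKΩ⟩ := exists_compact_between hb.isCompact_closure hΩ hcl
  obtain ⟨χ, h0, h1, h01⟩ := exists_contMDiffMap_zero_one_of_isClosed (n := 1)
    (modelWithCornersSelf ℝ E2) (s := (interior K)ᶜ) (t := closure E) isOpen_interior.isClosed_compl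
    isClosed_closure (by
      rw [Set.disjoint_left]; intro x hx hx2; exact hx (hEK hx2))
  refine ⟨K, χ, hK, hKΩ, χ.contMDiff.contDiff, ?_, fun x hx => h1 (subset_closure hx), fun x => h01 x⟩
  refine closure_minimal (fun x hx => ?_) hK.isClosed
  by_contra hxK
  exact hx (h0 (fun h => hxK (interior_subset h)))

lemma contDiff_cutoff_smul (Ω K : Set E2) (hΩ : IsOpen Ω) (hKΩ : K ⊆ Ω)
    (χ : E2 → ℝ) (hχ : ContDiff ℝ 1 χ) (hs : tsupport χ ⊆ K) (T : E2 → E2) (hT : ContDiffOn ℝ 1 T Ω) :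
    ContDiff ℝ 1 fun x => χ x • T x := by
  rw [contDiff_iff_contDiffAt]
  intro x
  by_cases hx : x ∈ Ω
  · exact hχ.contDiffAt.smul (hT.contDiffAt (hΩ.mem_nhds hx))
  · have hx' : x ∉ tsupport χ := fun h => hx (hKΩ (hs h))
    have : (fun x => χ x • T x) =ᶠ[nhds x] fun _ => 0 := by
      filter_upwards [(isClosed_tsupport χ).isOpen_compl.mem_nhds hx'] with y hy
      rw [image_eq_zero_of_notMem_tsupport hy, zero_smul]
    exact contDiffAt_const.congr_of_eventuallyEq this

lemma Tvf_contDiffOn (Ω : Set E2) (hΩ : IsOpen Ω) (u : E2 → ℝ) (hu : ContDiffOn ℝ 2 u Ω) :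
    ContDiffOn ℝ 1 (Tvf u) Ω := by
  have h1 : ContDiffOn ℝ 1 (fderiv ℝ u) Ω := hu.fderiv_of_isOpen hΩ (by norm_num)
  have h2 : ContDiffOn ℝ 1 (gradient u) Ω :=
    ((InnerProductSpace.toDual ℝ E2).symm.toContinuousLinearEquiv.contDiff (n := 1)).comp_contDiffOn h1
  have h3 : ContDiffOn ℝ 1 (fun x => 1 + ‖gradient u x‖ ^ 2) Ω := contDiffOn_const.add (h2.norm_sq ℝ)
  have hp : ∀ x, 0 < 1 + ‖gradient u x‖ ^ 2 := fun x => by positivity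
  exact ((h3.sqrt fun x _ => (hp x).ne').inv fun x _ => (Real.sqrt_pos.2 (hp x)).ne').smul h2

lemma norm_Tvf_lt (u : E2 → ℝ) (x : E2) : ‖Tvf u x‖ < 1 := by
  have hp : 0 < 1 + ‖gradient u x‖ ^ 2 := by positivity
  have hs := Real.sqrt_pos.2 hp
  rw [Tvf, norm_smul, norm_inv, Real.norm_of_nonneg hs.le, inv_mul_lt_iff₀ hs, mul_one]
  exact Real.lt_sqrt_of_sq_lt (by linarith)

lemma div2_congr {F G : E2 → E2} {x : E2} (h : F =ᶠ[nhds x] G) : div2 F x = div2 G x := by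
  simp only [div2, h.fderiv_eq]

/-- if `u` is a C² solution of `div(Tu) = λ` on an open set `Ω ⊂ ℝ²`,
then for every bounded open Lipschitz `E` compactly contained in `Ω` with `|E| > 0`
one has the strict inequality `λ < P(E)/|E|`. -/
theorem necessary_condition_compact_subsets (Ω : Set E2) (hΩopen : IsOpen Ω)
    (u : E2 → ℝ) (hu : ContDiffOn ℝ 2 u Ω) (lam : ℝ)
    (hpde : ∀ x ∈ Ω, div2 (Tvf u) x = lam) :
    ∀ E : Set E2, IsOpen E → Bornology.IsBounded E → HasLipschitzBoundary E →
      closure E ⊆ Ω → 0 < (volume E).toReal →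
      lam < perim E / (volume E).toReal := by
  intro E hE hb hL hcl hV
  have hfin := hausdorff_frontier_lt_top E hE hb hL
  obtain ⟨K, χ, hK, hKΩ, hχ, hs, hχ1, hχ01⟩ := exists_cutoff Ω E hΩopen hb hcl
  have hχc : HasCompactSupport χ := hK.of_isClosed_subset (isClosed_tsupport χ) hs
  have hcut : ∀ T : E2 → E2, ∀ x ∈ E, div2 (fun x => χ x • T x) x = div2 T x := by
    intro T x hx
    apply div2_congr
    filter_upwards [hE.mem_nhds hx] with y hy
    rw [hχ1 y hy, one_smul]
  have hgen : ∀ (T : E2 → E2), ContDiffOn ℝ 1 T Ω → ∀ m : ℝ, (∀ x ∈ E, div2 T x = m) →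
      ∃ x₀, m * (volume E).toReal ≤ ‖χ x₀ • T x₀‖ * perim E := by
    intro T hT m hm
    have hF := contDiff_cutoff_smul Ω K hΩopen hKΩ χ hχ hs T hT
    have hFs : HasCompactSupport fun x => χ x • T x := hχc.smul_right
    obtain ⟨x₀, hx₀⟩ := hF.continuous.norm.exists_forall_ge_of_hasCompactSupport hFs.norm
    refine ⟨x₀, ?_⟩
    have h1 := main_ineq E hE hb hfin _ hF hFs _ hx₀
    rw [setIntegral_congr_fun (g := fun _ => m) hE.measurableSet
      (fun x hx => (hcut T x hx).trans (hm x hx))] at h1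
    simpa [Measure.real, mul_comm] using h1
  have hP : 0 < perim E := by
    obtain ⟨x₀, hx₀⟩ := hgen id contDiffOn_id 2 (fun x _ => by simp [div2, fderiv_id])
    have h0 : 0 ≤ perim E := ENNReal.toReal_nonneg
    rcases h0.eq_or_lt with h | h
    · rw [← h] at hx₀; linarith
    · exact h
  obtain ⟨x₀, hx₀⟩ := hgen (Tvf u) (Tvf_contDiffOn Ω hΩopen u hu) lam
    (fun x hx => hpde x (hcl (subset_closure hx)))
  rw [lt_div_iff₀ hV]
  refine hx₀.trans_lt ?_
  have hlt : ‖χ x₀ • Tvf u x₀‖ < 1 := by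
    rw [norm_smul, Real.norm_of_nonneg (hχ01 x₀).1]
    exact (mul_le_of_le_one_left (norm_nonneg _) (hχ01 x₀).2).trans_lt (norm_Tvf_lt u x₀)
  exact (mul_lt_mul_of_pos_right hlt hP).trans_eq (one_mul _)
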